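/- Let M/F be a finite Galois extension of fields with Galois group G, and let q ∈ F^× be an element of infinite multiplicative order, so that the subgroup ⟨q⟩ of M^× generated by q is a G-stable subgroup isomorphic to ℤ with trivial G-action. Then there is an injective group homomorphism from H^1(G, M^×/⟨q⟩) into H^2(G, ℤ) (ℤ with trivial G-action), which is isomorphic to Hom(G, ℚ/ℤ); in particular H^1(G, M^×/⟨q⟩) embeds into Hom(G, ℚ/ℤ). -/

import Mathlib

namespace Statement14

variable (F M : Type) [Field F] [Field M] [Algebra F M]

/-- The Galois group `G = Gal(M/F)`. -/
abbrev G := M ≃ₐ[F] M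

/-- `q`, viewed as a unit of `M`. -/
noncomputable def u (q : F) (hq0 : q ≠ 0) : Mˣ :=
  Units.map (algebraMap F M).toMonoidHom (Units.mk0 q hq0)

/-- The `G`-stable subgroup `⟨q⟩ ≤ M^×` generated by `q`. -/
noncomputable abbrev N (q : F) (hq0 : q ≠ 0) : Subgroup Mˣ :=
  Subgroup.zpowers (u F M q hq0)

/-- The quotient `G`-module `M^×/⟨q⟩` (written multiplicatively). -/
abbrev Q (q : F) (hq0 : q ≠ 0) := Mˣ ⧸ N F M q hq0

/-- The natural action of `σ ∈ G` on `M^×/⟨q⟩` (well defined since `σ q = q`). -/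
noncomputable def qact (q : F) (hq0 : q ≠ 0) (σ : G F M) :
    Q F M q hq0 →* Q F M q hq0 :=
  QuotientGroup.map _ _ (Units.map (σ.toAlgHom.toRingHom.toMonoidHom)) (by
    intro x hx
    obtain ⟨n, rfl⟩ := Subgroup.mem_zpowers_iff.mp hx
    refine Subgroup.mem_comap.mpr ?_
    rw [map_zpow]
    have hu : (Units.map (σ.toAlgHom.toRingHom.toMonoidHom)) (u F M q hq0) = u F M q hq0 := by
      ext
      simp [u, σ.commutes q]
    rw [hu]
    exact Subgroup.zpow_mem _ (Subgroup.mem_zpowers _) n)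

/-- The group of 1-cocycles of `G` with values in `M^×/⟨q⟩`. -/
noncomputable def Z1 (q : F) (hq0 : q ≠ 0) : Subgroup (G F M → Q F M q hq0) where
  carrier := {c | ∀ σ τ : G F M, c (σ * τ) = c σ * qact F M q hq0 σ (c τ)}
  one_mem' := by intro σ τ; simp
  mul_mem' := by
    intro a b ha hb σ τ
    have h1 := ha σ τ
    have h2 := hb σ τ
    simp only [Pi.mul_apply, h1, h2, map_mul]
    exact mul_mul_mul_comm (a σ) (qact F M q hq0 σ (a τ)) (b σ) (qact F M q hq0 σ (b τ))
  inv_mem' := by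
    intro a ha σ τ
    have h1 := ha σ τ
    simp only [Pi.inv_apply, h1, map_inv]
    exact mul_inv (a σ) ((qact F M q hq0 σ) (a τ))

/-- The subgroup of 1-coboundaries. -/
noncomputable def B1 (q : F) (hq0 : q ≠ 0) : Subgroup (G F M → Q F M q hq0) where
  carrier := {c | ∃ x : Q F M q hq0, ∀ σ : G F M, c σ = qact F M q hq0 σ x * x⁻¹}
  one_mem' := ⟨1, fun σ => by
    rw [Pi.one_apply, map_one, inv_one]
    exact (mul_one (1 : Q F M q hq0)).symm⟩
  mul_mem' := by
    rintro a b ⟨x, hx⟩ ⟨y, hy⟩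
    refine ⟨x * y, fun σ => ?_⟩
    simp only [Pi.mul_apply, hx σ, hy σ, map_mul]
    rw [mul_inv x y]
    exact mul_mul_mul_comm ((qact F M q hq0 σ) x) x⁻¹ ((qact F M q hq0 σ) y) y⁻¹
  inv_mem' := by
    rintro a ⟨x, hx⟩
    refine ⟨x⁻¹, fun σ => ?_⟩
    rw [Pi.inv_apply, hx σ, map_inv, mul_inv ((qact F M q hq0 σ) x) x⁻¹]

/-- The first cohomology group `H¹(G, M^×/⟨q⟩)` = 1-cocycles modulo 1-coboundaries. -/
abbrev H1 (q : F) (hq0 : q ≠ 0) :=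
  Z1 F M q hq0 ⧸ ((B1 F M q hq0).subgroupOf (Z1 F M q hq0))

/-- The group of 2-cocycles of `G` with values in `ℤ` (trivial action). -/
def Z2 : AddSubgroup (G F M → G F M → ℤ) where
  carrier := {c | ∀ σ τ ρ : G F M, c (σ * τ) ρ + c σ τ = c σ (τ * ρ) + c τ ρ}
  zero_mem' := by intro σ τ ρ; simp
  add_mem' := by
    intro a b ha hb σ τ ρ
    have h1 := ha σ τ ρ
    have h2 := hb σ τ ρ
    simp only [Pi.add_apply]
    omega
  neg_mem' := by
    intro a ha σ τ ρ
    have h1 := ha σ τ ρ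
    simp only [Pi.neg_apply]
    omega

/-- The 2-coboundary homomorphism. -/
def d2 : (G F M → ℤ) →+ (G F M → G F M → ℤ) where
  toFun b := fun σ τ => b τ - b (σ * τ) + b σ
  map_zero' := by funext σ τ; simp
  map_add' := by
    intro a b
    funext σ τ
    simp only [Pi.add_apply]
    ring

/-- The second cohomology group `H²(G, ℤ)` (trivial `G`-action on `ℤ`)
= 2-cocycles modulo 2-coboundaries. -/
abbrev H2 := Z2 F M ⧸ ((d2 F M).range.addSubgroupOf (Z2 F M))

/-- `ℚ/ℤ`. -/
abbrev QmodZ := ℚ ⧸ AddSubgroup.zmultiples (1 : ℚ)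

instance normalB1 (q : F) (hq0 : q ≠ 0) :
    ((B1 F M q hq0).subgroupOf (Z1 F M q hq0)).Normal := by
  constructor
  intro n hn g
  rw [Subgroup.mem_subgroupOf] at hn ⊢
  have hcoe : ((g * n * g⁻¹ : Z1 F M q hq0) : G F M → Q F M q hq0) = (n : G F M → Q F M q hq0) := by
    rw [Subgroup.coe_mul, Subgroup.coe_mul, Subgroup.coe_inv,
      mul_comm ((g : G F M → Q F M q hq0)) ((n : G F M → Q F M q hq0))]
    exact mul_inv_cancel_right ((n : G F M → Q F M q hq0)) ((g : G F M → Q F M q hq0))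
  rw [hcoe]
  exact hn

/-- A total multiplicative relation between `A` and `C` whose kernel is `K` on the left and trivial
on the right yields an injective homomorphism `A ⧸ K →* C`. -/
theorem exists_hom_of_rel {A C : Type*} [Group A] [Group C] (K : Subgroup A) [K.Normal]
    (P : A → C → Prop)
    (hmul : ∀ a a' c c', P a c → P a' c' → P (a * a') (c * c'))
    (hinv : ∀ a c, P a c → P a⁻¹ c⁻¹)
    (htot : ∀ a, ∃ c, P a c)
    (hker : ∀ a c, P a c → (a ∈ K ↔ c = 1)) :
    ∃ φ : A ⧸ K →* C, Function.Injective φ ∧ ∀ a c, P a c → φ (QuotientGroup.mk a) = c := by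
  have huniq : ∀ a c c', P a c → P a c' → c = c' := by
    intro a c c' h h'
    have h1 := hmul _ _ _ _ h (hinv _ _ h')
    rw [mul_inv_cancel] at h1
    exact mul_inv_eq_one.mp ((hker _ _ h1).mp K.one_mem)
  choose f hf using htot
  let g : A →* C := MonoidHom.mk' f (fun a b =>
    huniq _ _ _ (hf _) (hmul _ _ _ _ (hf a) (hf b)))
  have hg : g.ker = K := by
    ext a
    rw [MonoidHom.mem_ker]
    exact (hker a (f a) (hf a)).symm
  refine ⟨QuotientGroup.lift K g (fun a ha => hg.ge ha), ?_, ?_⟩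
  · rw [injective_iff_map_eq_one]
    intro x hx
    obtain ⟨a, rfl⟩ := QuotientGroup.mk_surjective x
    rw [QuotientGroup.lift_mk] at hx
    rw [QuotientGroup.eq_one_iff, ← hg]
    exact hx
  · intro a c h
    rw [QuotientGroup.lift_mk]
    exact huniq _ _ _ (hf a) h

/-- Additive version of `exists_hom_of_rel`. -/
theorem exists_hom_of_rel_add {A C : Type*} [AddGroup A] [AddGroup C] (K : AddSubgroup A)
    [K.Normal] (P : A → C → Prop)
    (hadd : ∀ a a' c c', P a c → P a' c' → P (a + a') (c + c'))
    (hneg : ∀ a c, P a c → P (-a) (-c))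
    (htot : ∀ a, ∃ c, P a c)
    (hker : ∀ a c, P a c → (a ∈ K ↔ c = 0)) :
    ∃ φ : A ⧸ K →+ C, Function.Injective φ ∧ ∀ a c, P a c → φ (QuotientAddGroup.mk a) = c := by
  have huniq : ∀ a c c', P a c → P a c' → c = c' := by
    intro a c c' h h'
    have h1 := hadd _ _ _ _ h (hneg _ _ h')
    rw [add_neg_cancel] at h1
    exact add_neg_eq_zero.mp ((hker _ _ h1).mp K.zero_mem)
  choose f hf using htot
  let g : A →+ C := AddMonoidHom.mk' f (fun a b =>
    huniq _ _ _ (hf _) (hadd _ _ _ _ (hf a) (hf b)))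
  have hg : g.ker = K := by
    ext a
    rw [AddMonoidHom.mem_ker]
    exact (hker a (f a) (hf a)).symm
  refine ⟨QuotientAddGroup.lift K g (fun a ha => hg.ge ha), ?_, ?_⟩
  · rw [injective_iff_map_eq_zero]
    intro x hx
    obtain ⟨a, rfl⟩ := QuotientAddGroup.mk_surjective x
    rw [QuotientAddGroup.lift_mk] at hx
    rw [QuotientAddGroup.eq_zero_iff, ← hg]
    exact hx
  · intro a c h
    rw [QuotientAddGroup.lift_mk]
    exact huniq _ _ _ (hf a) h

theorem qz_eq_zero (x : ℚ) : (QuotientAddGroup.mk x : QmodZ) = 0 ↔ ∃ n : ℤ, (n : ℚ) = x := by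
  rw [QuotientAddGroup.eq_zero_iff, AddSubgroup.mem_zmultiples_iff]
  simp

/-- `H²(G, ℤ) ≃ Hom(G, ℚ/ℤ)`. -/
theorem h2_equiv [FiniteDimensional F M] :
    Nonempty (H2 F M ≃+ (Additive (G F M) →+ QmodZ)) := by
  classical
  let P : Z2 F M → (Additive (G F M) →+ QmodZ) → Prop := fun n χ =>
    ∃ b : G F M → ℚ, (∀ σ τ, b τ - b (σ * τ) + b σ = (n.1 σ τ : ℚ)) ∧
      ∀ σ, χ (Additive.ofMul σ) = (QuotientAddGroup.mk (b σ) : QmodZ)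
  obtain ⟨φ, hinj, hφ⟩ := exists_hom_of_rel_add ((d2 F M).range.addSubgroupOf (Z2 F M)) P
    (by
      rintro a a' c c' ⟨b, hb, hc⟩ ⟨b', hb', hc'⟩
      refine ⟨b + b', fun σ τ => ?_, fun σ => ?_⟩
      · have := hb σ τ
        have := hb' σ τ
        simp only [Pi.add_apply, AddSubgroup.coe_add, Int.cast_add]
        linarith
      · rw [AddMonoidHom.add_apply, hc, hc']; rfl)
    (by
      rintro a c ⟨b, hb, hc⟩
      refine ⟨-b, fun σ τ => ?_, fun σ => ?_⟩
      · have := hb σ τ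
        simp only [Pi.neg_apply, AddSubgroup.coe_neg, Int.cast_neg]
        linarith
      · rw [AddMonoidHom.neg_apply, hc]; rfl)
    (by
      intro n
      let b : G F M → ℚ := fun σ => (∑ ρ, (n.1 σ ρ : ℚ)) / (Fintype.card (G F M) : ℚ)
      have hcard : (Fintype.card (G F M) : ℚ) ≠ 0 := by
        exact_mod_cast Fintype.card_ne_zero
      have hb : ∀ σ τ, b τ - b (σ * τ) + b σ = (n.1 σ τ : ℚ) := by
        intro σ τ
        have h1 : ∑ ρ, ((n.1 (σ * τ) ρ : ℚ) + n.1 σ τ) = ∑ ρ, ((n.1 σ (τ * ρ) : ℚ) + n.1 τ ρ) :=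
          Finset.sum_congr rfl (fun ρ _ => by exact_mod_cast n.2 σ τ ρ)
        have h2 : ∑ ρ, (n.1 σ (τ * ρ) : ℚ) = ∑ ρ, (n.1 σ ρ : ℚ) :=
          Fintype.sum_equiv (Equiv.mulLeft τ) _ _ (fun _ => rfl)
        rw [Finset.sum_add_distrib, Finset.sum_add_distrib, h2, Finset.sum_const,
          Finset.card_univ, nsmul_eq_mul] at h1
        simp only [b]
        field_simp
        linarith
      refine ⟨AddMonoidHom.mk' (fun σ => (QuotientAddGroup.mk (b σ.toMul) : QmodZ)) ?_,
        b, hb, fun σ => rfl⟩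
      intro σ τ
      rw [← QuotientAddGroup.mk_add, toMul_add, ← sub_eq_zero, ← QuotientAddGroup.mk_sub,
        qz_eq_zero]
      refine ⟨-n.1 σ.toMul τ.toMul, ?_⟩
      rw [Int.cast_neg, ← hb]
      ring)
    (by
      rintro n χ ⟨b, hb, hc⟩
      rw [AddSubgroup.mem_addSubgroupOf]
      constructor
      · rintro ⟨b', hb'⟩
        have key : ∀ σ, b σ = b' σ := by
          let e : Additive (G F M) →+ ℚ := AddMonoidHom.mk'
            (fun σ => b σ.toMul - b' σ.toMul) (by
              intro σ τ
              have h1 := hb σ.toMul τ.toMul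
              rw [← hb'] at h1
              simp only [d2, AddMonoidHom.coe_mk, ZeroHom.coe_mk] at h1
              push_cast at h1
              rw [toMul_add]
              linarith)
          intro σ
          have h0 : (Fintype.card (G F M)) • e (Additive.ofMul σ) = 0 := by
            rw [← map_nsmul, ← ofMul_pow, pow_card_eq_one, ofMul_one, map_zero]
          have h1 : e (Additive.ofMul σ) = 0 := by
            rcases smul_eq_zero.mp h0 with h | h
            · exact absurd h Fintype.card_ne_zero
            · exact h
          exact sub_eq_zero.mp h1
        ext σ
        change χ (Additive.ofMul σ) = 0
        rw [hc, qz_eq_zero]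
        exact ⟨_, (key _).symm⟩
      · rintro rfl
        have h1 : ∀ σ, ∃ m : ℤ, (m : ℚ) = b σ := fun σ => by
          rw [← qz_eq_zero, ← hc]; rfl
        choose b' hb' using h1
        refine ⟨b', ?_⟩
        funext σ τ
        have := hb σ τ
        rw [← hb', ← hb', ← hb'] at this
        exact_mod_cast this)
  refine ⟨AddEquiv.ofBijective φ ⟨hinj, fun χ => ?_⟩⟩
  have h1 : ∀ σ : G F M, ∃ x : ℚ, (QuotientAddGroup.mk x : QmodZ) = χ (Additive.ofMul σ) :=
    fun σ => QuotientAddGroup.mk_surjective _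
  choose b hb using h1
  have h2 : ∀ σ τ, ∃ m : ℤ, (m : ℚ) = b τ - b (σ * τ) + b σ := by
    intro σ τ
    rw [← qz_eq_zero, QuotientAddGroup.mk_add, QuotientAddGroup.mk_sub, hb, hb, hb, ofMul_mul,
      map_add]
    abel
  choose n hn using h2
  have hz : n ∈ Z2 F M := by
    intro σ τ ρ
    have h3 : ((n (σ * τ) ρ + n σ τ : ℤ) : ℚ) = ((n σ (τ * ρ) + n τ ρ : ℤ) : ℚ) := by
      push_cast
      rw [hn, hn, hn, hn, mul_assoc]
      ring
    exact_mod_cast h3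
  exact ⟨QuotientAddGroup.mk ⟨n, hz⟩, hφ _ _ ⟨b, fun σ τ => (hn σ τ).symm, fun σ => (hb σ).symm⟩⟩

theorem u_zpow_inj (q : F) (hq0 : q ≠ 0) (hq : ∀ n : ℕ, 0 < n → q ^ n ≠ 1) {m n : ℤ}
    (h : u F M q hq0 ^ m = u F M q hq0 ^ n) : m = n := by
  have hinj : Function.Injective (fun n : ℤ => u F M q hq0 ^ n) := by
    rw [injective_zpow_iff_not_isOfFinOrder, isOfFinOrder_iff_pow_eq_one]
    rintro ⟨k, hk, h1⟩
    refine hq k hk ((algebraMap F M).injective ?_)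
    have := congrArg Units.val h1
    simpa [u] using this
  exact hinj h

/-- The action of `σ` on units. -/
abbrev act (σ : G F M) : Mˣ →* Mˣ := Units.map (σ.toAlgHom.toRingHom.toMonoidHom)

theorem act_u (q : F) (hq0 : q ≠ 0) (σ : G F M) : act F M σ (u F M q hq0) = u F M q hq0 := by
  ext
  simp [u, σ.commutes q]

theorem act_mul (σ τ : G F M) (x : Mˣ) : act F M (σ * τ) x = act F M σ (act F M τ x) := by
  ext
  rfl

theorem qact_mk (q : F) (hq0 : q ≠ 0) (σ : G F M) (x : Mˣ) :
    qact F M q hq0 σ (QuotientGroup.mk x) = QuotientGroup.mk (act F M σ x) := rfl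

theorem mk_eq (q : F) (hq0 : q ≠ 0) (x y : Mˣ) :
    (QuotientGroup.mk x : Q F M q hq0) = QuotientGroup.mk y ↔
      ∃ n : ℤ, y = x * u F M q hq0 ^ n := by
  rw [QuotientGroup.eq, Subgroup.mem_zpowers_iff]
  constructor
  · rintro ⟨n, h⟩
    exact ⟨n, by rw [h]; group⟩
  · rintro ⟨n, h⟩
    exact ⟨n, by rw [h]; group⟩

theorem hilbert90 [FiniteDimensional F M] (l : G F M → Mˣ)
    (hl : ∀ σ τ, l σ * act F M σ (l τ) = l (σ * τ)) :
    ∃ y : Mˣ, ∀ σ, l σ = act F M σ y * y⁻¹ := by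
  obtain ⟨y, hy⟩ := groupCohomology.isMulCoboundary₁_of_isMulCocycle₁_of_aut_to_units
    (K := F) (L := M) l (fun σ τ => by
      rw [← hl, mul_comm]; rfl)
  refine ⟨y, fun σ => ?_⟩
  rw [← hy σ, div_eq_mul_inv]
  rfl

theorem h1_embed [FiniteDimensional F M]
    (q : F) (hq0 : q ≠ 0) (hq : ∀ n : ℕ, 0 < n → q ^ n ≠ 1) :
    ∃ φ : H1 F M q hq0 →* Multiplicative (H2 F M), Function.Injective φ := by
  let U := u F M q hq0
  let P : Z1 F M q hq0 → Multiplicative (H2 F M) → Prop := fun c y =>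
    ∃ (n : Z2 F M) (l : G F M → Mˣ), (∀ σ, c.1 σ = QuotientGroup.mk (l σ)) ∧
      (∀ σ τ, l σ * act F M σ (l τ) = l (σ * τ) * U ^ (n.1 σ τ)) ∧
      y = Multiplicative.ofAdd (QuotientAddGroup.mk n : H2 F M)
  have hU : ∀ σ (k : ℤ), act F M σ (U ^ k) = U ^ k := fun σ k => by
    rw [map_zpow, act_u]
  obtain ⟨φ, hinj, -⟩ := exists_hom_of_rel
    ((B1 F M q hq0).subgroupOf (Z1 F M q hq0)) P
    (by
      rintro c c' y y' ⟨n, l, hc, hn, rfl⟩ ⟨n', l', hc', hn', rfl⟩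
      refine ⟨n + n', l * l', fun σ => ?_, fun σ τ => ?_, rfl⟩
      · rw [Subgroup.coe_mul, Pi.mul_apply, hc, hc']; rfl
      · simp only [Pi.mul_apply, AddSubgroup.coe_add, Pi.add_apply, map_mul, zpow_add]
        rw [mul_mul_mul_comm, hn, hn', mul_mul_mul_comm])
    (by
      rintro c y ⟨n, l, hc, hn, rfl⟩
      refine ⟨-n, l⁻¹, fun σ => ?_, fun σ τ => ?_, rfl⟩
      · rw [Subgroup.coe_inv, Pi.inv_apply, hc]; rfl
      · simp only [Pi.inv_apply, AddSubgroup.coe_neg, Pi.neg_apply, map_inv, zpow_neg]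
        rw [← mul_inv, hn, mul_inv])
    (by
      intro c
      have h1 : ∀ σ, ∃ x : Mˣ, (QuotientGroup.mk x : Q F M q hq0) = c.1 σ :=
        fun σ => QuotientGroup.mk_surjective _
      choose l hl using h1
      have h2 : ∀ σ τ, ∃ n : ℤ, l σ * act F M σ (l τ) = l (σ * τ) * U ^ n := by
        intro σ τ
        rw [← mk_eq, hl, c.2 σ τ, ← hl, ← hl, qact_mk]
        rfl
      choose n hn using h2
      refine ⟨_, ⟨n, ?_⟩, l, fun σ => (hl σ).symm, hn, rfl⟩
      intro σ τ ρ
      apply u_zpow_inj F M q hq0 hq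
      change U ^ _ = U ^ _
      have e1 : l σ * act F M σ (l τ) * act F M (σ * τ) (l ρ)
          = l (σ * τ * ρ) * U ^ (n (σ * τ) ρ + n σ τ) := by
        rw [hn, mul_right_comm, hn, zpow_add, mul_assoc]
      have e2 : l σ * act F M σ (l τ) * act F M (σ * τ) (l ρ)
          = l (σ * τ * ρ) * U ^ (n σ (τ * ρ) + n τ ρ) := by
        rw [act_mul, mul_assoc, ← map_mul, hn, map_mul, hU, ← mul_assoc, hn, zpow_add,
          mul_assoc, mul_assoc σ τ ρ]
      exact mul_left_cancel (e1.symm.trans e2))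
    (by
      rintro c y ⟨n, l, hc, hn, rfl⟩
      rw [ofAdd_eq_one, QuotientAddGroup.eq_zero_iff, AddSubgroup.mem_addSubgroupOf,
        Subgroup.mem_subgroupOf]
      constructor
      · rintro ⟨x, hx⟩
        obtain ⟨z, rfl⟩ := QuotientGroup.mk_surjective x
        have h1 : ∀ σ, ∃ b : ℤ, l σ = act F M σ z * z⁻¹ * U ^ b := by
          intro σ
          rw [← mk_eq, ← hc, hx σ, qact_mk]
          rfl
        choose b hb using h1
        refine ⟨b, ?_⟩
        funext σ τ
        apply u_zpow_inj F M q hq0 hq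
        change U ^ (b τ - b (σ * τ) + b σ) = U ^ _
        have h2 := hn σ τ
        rw [hb, hb, hb, map_mul, map_mul, map_inv, hU, ← act_mul] at h2
        have h3 : U ^ n.1 σ τ = (act F M (σ * τ) z * z⁻¹ * U ^ b (σ * τ))⁻¹ *
            (act F M σ z * z⁻¹ * U ^ b σ *
              (act F M (σ * τ) z * (act F M σ z)⁻¹ * U ^ b τ)) := by
          rw [h2, inv_mul_cancel_left]
        rw [h3, zpow_add, zpow_sub]
        generalize act F M (σ * τ) z = s
        generalize act F M σ z = t
        generalize U ^ b σ = v1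
        generalize U ^ b τ = v2
        generalize U ^ b (σ * τ) = v3
        ext
        push_cast
        field_simp
      · rintro ⟨b, hb⟩
        obtain ⟨y, hy⟩ := hilbert90 F M (fun σ => l σ * U ^ (-b σ)) (by
          intro σ τ
          have h2 := hn σ τ
          rw [← hb] at h2
          change _ = l (σ * τ) * U ^ (b τ - b (σ * τ) + b σ) at h2
          rw [map_mul, hU, mul_mul_mul_comm, h2, mul_assoc, ← zpow_add, ← zpow_add]
          congr 2
          ring)
        refine ⟨QuotientGroup.mk y, fun σ => ?_⟩
        rw [hc, qact_mk]
        change _ = (QuotientGroup.mk (act F M σ y * y⁻¹) : Q F M q hq0)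
        rw [mk_eq]
        exact ⟨_, (hy σ).symm⟩)
  exact ⟨φ, hinj⟩

theorem statement14 [FiniteDimensional F M] [IsGalois F M]
    (q : F) (hq0 : q ≠ 0) (hq : ∀ n : ℕ, 0 < n → q ^ n ≠ 1) :
    (∃ φ : H1 F M q hq0 →* Multiplicative (H2 F M), Function.Injective φ) ∧
    Nonempty (H2 F M ≃+ (Additive (G F M) →+ QmodZ)) ∧
    (∃ ψ : H1 F M q hq0 →* Multiplicative (Additive (G F M) →+ QmodZ),
      Function.Injective ψ) := by
  obtain ⟨φ, hφ⟩ := h1_embed F M q hq0 hq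
  obtain ⟨e⟩ := h2_equiv F M
  exact ⟨⟨φ, hφ⟩, ⟨e⟩, ⟨(AddMonoidHom.toMultiplicative e.toAddMonoidHom).comp φ,
    fun x y hxy => hφ (e.injective hxy)⟩⟩

end Statement14
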